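/- Let d ≥ 2 be an integer, let K₀ ⊂ ℝ^d be a convex body, and let 0 < ε₁ ≤ min{1/2, 2^{−2d−1}·(κ_{d−1}/(d·κ_d²))·|K₀|/(diam K₀)^d}, where κ_d is the volume of the d-dimensional Euclidean unit ball and diam denotes Euclidean diameter. Let K ⊂ ℝ^d be a convex body with (1−ε₁)·K₀ ⊆ K ⊆ (1+ε₁)·K₀. Let s(K) and s(K₀) denote the Santaló points of K and K₀, i.e., s(K) is the (unique) point of the interior of K minimizing z ↦ |(K−z)*| over z in the interior of K, and likewise for s(K₀). Then ‖s(K) − s(K₀)‖ ≤ c₁(K₀)·ε₁, where c₁(K₀) := (diam K₀)^{(d+1)²}·|K₀|^{−d−2}·d·(d·κ_d/κ_{d−1})^{d+2}. -/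

import Mathlib

open MeasureTheory Pointwise Real
open scoped RealInnerProductSpace

/-- `d`-dimensional Lebesgue measure (volume) of a subset of `ℝ^d`. -/
noncomputable def vol {d : ℕ} (K : Set (EuclideanSpace ℝ (Fin d))) : ℝ := (volume K).toReal

/-- The polar body `K* = {x : ⟨x,y⟩ ≤ 1 for all y ∈ K}`. -/
def polarBody {d : ℕ} (K : Set (EuclideanSpace ℝ (Fin d))) : Set (EuclideanSpace ℝ (Fin d)) :=
  {x | ∀ y ∈ K, ⟪x, y⟫ ≤ 1}

/-- A convex body: a compact convex set with nonempty interior. -/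
def IsConvexBody {d : ℕ} (K : Set (EuclideanSpace ℝ (Fin d))) : Prop :=
  Convex ℝ K ∧ IsCompact K ∧ (interior K).Nonempty

/-- `κ_m`, the volume of the Euclidean unit ball in `ℝ^m`. -/
noncomputable def unitBallVol (m : ℕ) : ℝ :=
  (volume (Metric.ball (0 : EuclideanSpace ℝ (Fin m)) 1)).toReal

/-- `s` is a Santaló point of `K`: an interior point minimizing `z ↦ |(K−z)*|`. -/
def IsSantaloPoint {d : ℕ} (K : Set (EuclideanSpace ℝ (Fin d)))
    (s : EuclideanSpace ℝ (Fin d)) : Prop :=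
  s ∈ interior K ∧
    ∀ z ∈ interior K, vol (polarBody ((· - s) '' K)) ≤ vol (polarBody ((· - z) '' K))

section Gauge

variable {E : Type*} [NormedAddCommGroup E] [InnerProductSpace ℝ E]

/-- A sublinear function comparable to the norm: the gauge of a bounded convex set with the origin
in its interior. -/
structure IsGauge (p : E → ℝ) : Prop where
  map_smul : ∀ c : ℝ, 0 ≤ c → ∀ x, p (c • x) = c * p x
  map_add_le : ∀ x y, p (x + y) ≤ p x + p y
  exists_lower : ∃ m : ℝ, 0 < m ∧ ∀ x, m * ‖x‖ ≤ p x
  exists_upper : ∃ M : ℝ, 0 < M ∧ ∀ x, p x ≤ M * ‖x‖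

lemma isGauge_mul_norm {k : ℝ} (hk : 0 < k) : IsGauge (fun x : E => k * ‖x‖) where
  map_smul c hc x := by rw [norm_smul, Real.norm_of_nonneg hc]; ring
  map_add_le x y := by nlinarith [norm_add_le x y]
  exists_lower := ⟨k, hk, fun _ => le_rfl⟩
  exists_upper := ⟨k, hk, fun _ => le_rfl⟩

namespace IsGauge

variable {p : E → ℝ}

lemma const_mul (hp : IsGauge p) {k : ℝ} (hk : 0 < k) : IsGauge (fun x => k * p x) where
  map_smul c hc x := by rw [hp.map_smul c hc]; ring
  map_add_le x y := by nlinarith [hp.map_add_le x y]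
  exists_lower := by
    obtain ⟨m, hm, h⟩ := hp.exists_lower
    exact ⟨k * m, mul_pos hk hm, fun x => by nlinarith [h x]⟩
  exists_upper := by
    obtain ⟨M, hM, h⟩ := hp.exists_upper
    exact ⟨k * M, mul_pos hk hM, fun x => by nlinarith [h x]⟩

lemma nonneg (hp : IsGauge p) (x : E) : 0 ≤ p x := by
  obtain ⟨m, hm, h⟩ := hp.exists_lower
  exact (by positivity : 0 ≤ m * ‖x‖).trans (h x)

lemma continuous (hp : IsGauge p) : Continuous p := by
  obtain ⟨M, hM, h⟩ := hp.exists_upper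
  have key : ∀ x y, p x - p y ≤ M * ‖x - y‖ := fun x y => by
    have h1 := hp.map_add_le (x - y) y
    rw [sub_add_cancel] at h1
    linarith [h (x - y)]
  refine (LipschitzWith.of_dist_le_mul (K := M.toNNReal) fun x y => ?_).continuous
  rw [Real.coe_toNNReal _ hM.le, Real.dist_eq, dist_eq_norm, abs_le]
  have h2 := key y x
  rw [norm_sub_rev] at h2
  exact ⟨by linarith, key x y⟩

variable [FiniteDimensional ℝ E] [MeasurableSpace E] [BorelSpace E]

lemma integrable (hp : IsGauge p) {f : E → ℝ} (hf : Continuous f) (C : ℝ) (k : ℕ)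
    (hb : ∀ x, |f x| ≤ C * (1 + ‖x‖) ^ k) :
    Integrable fun x => f x * exp (-p x) := by
  obtain ⟨m, hm, h⟩ := hp.exists_lower
  set N := Module.finrank ℝ E + 1 with hN
  have hint : Integrable (fun x : E => (1 + ‖x‖) ^ (-(N : ℝ))) :=
    integrable_one_add_norm (by rw [hN]; push_cast; linarith)
  refine (hint.const_mul (C * ((N + k).factorial * exp m / m ^ (N + k)))).mono'
    (hf.mul (continuous_exp.comp hp.continuous.neg)).aestronglyMeasurable
    (Filter.Eventually.of_forall fun x => ?_)
  have hx : 0 ≤ ‖x‖ := norm_nonneg x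
  have hC : 0 ≤ C := by
    have := (abs_nonneg _).trans (hb x)
    exact nonneg_of_mul_nonneg_left this (by positivity)
  have h1 := Real.pow_div_factorial_le_exp (m * (1 + ‖x‖)) (by positivity) (N + k)
  have h2 : (1 + ‖x‖) ^ (N + k) * exp (-p x) ≤ (N + k).factorial * exp m / m ^ (N + k) := by
    rw [div_le_iff₀ (by positivity), mul_pow] at h1
    rw [le_div_iff₀ (by positivity)]
    have h3 : exp (-p x) ≤ exp (-(m * ‖x‖)) := exp_le_exp.2 (by linarith [h x])
    have h4 : exp (m * (1 + ‖x‖)) * exp (-(m * ‖x‖)) = exp m := by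
      rw [← exp_add]; ring_nf
    calc (1 + ‖x‖) ^ (N + k) * exp (-p x) * m ^ (N + k)
        ≤ (1 + ‖x‖) ^ (N + k) * exp (-(m * ‖x‖)) * m ^ (N + k) := by gcongr
      _ = m ^ (N + k) * (1 + ‖x‖) ^ (N + k) * exp (-(m * ‖x‖)) := by ring
      _ ≤ exp (m * (1 + ‖x‖)) * (N + k).factorial * exp (-(m * ‖x‖)) := by gcongr
      _ = _ := by rw [← h4]; ring
  rw [Real.norm_eq_abs, abs_mul, abs_of_pos (exp_pos _), rpow_neg (by positivity), rpow_natCast,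
    mul_assoc, mul_comm, ← div_eq_mul_inv, mul_comm C, mul_comm]
  rw [← mul_div_right_comm]
  calc |f x| * exp (-p x) ≤ C * (1 + ‖x‖) ^ k * exp (-p x) := by gcongr; exact hb x
    _ = (1 + ‖x‖) ^ (N + k) * exp (-p x) * C / (1 + ‖x‖) ^ N := by
      rw [pow_add]; field_simp
    _ ≤ _ := by gcongr

lemma integrable_exp_neg (hp : IsGauge p) : Integrable fun x => exp (-p x) := by
  simpa using hp.integrable (f := fun _ => 1) continuous_const 1 0 (by simp)

lemma integrable_mul_exp_neg (hp : IsGauge p) : Integrable fun x => p x * exp (-p x) := by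
  obtain ⟨M, hM, h⟩ := hp.exists_upper
  refine hp.integrable hp.continuous M 1 fun x => ?_
  rw [abs_of_nonneg (hp.nonneg x)]
  nlinarith [h x]

lemma integrable_inner_mul_exp_neg (hp : IsGauge p) (v : E) :
    Integrable fun x => ⟪v, x⟫ * exp (-p x) := by
  refine hp.integrable (by fun_prop) ‖v‖ 1 fun x => (abs_real_inner_le_norm v x).trans ?_
  nlinarith [norm_nonneg v]

lemma integrable_inner_sq_mul_exp_neg (hp : IsGauge p) (v : E) :
    Integrable fun x => ⟪v, x⟫ ^ 2 * exp (-p x) := by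
  refine hp.integrable (by fun_prop) (‖v‖ ^ 2) 2 fun x => ?_
  rw [abs_pow, ← mul_pow]
  have := abs_real_inner_le_norm v x
  gcongr
  nlinarith [norm_nonneg v]

lemma integrable_norm_sq_mul_exp_neg (hp : IsGauge p) :
    Integrable fun x => ‖x‖ ^ 2 * exp (-p x) := by
  refine hp.integrable (by fun_prop) 1 2 fun x => ?_
  rw [abs_of_nonneg (by positivity), one_mul]
  gcongr
  linarith

lemma integral_exp_neg_pos (hp : IsGauge p) : 0 < ∫ x, exp (-p x) :=
  integral_exp_pos hp.integrable_exp_neg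

lemma integral_norm_sq_mul_exp_neg_pos [Nontrivial E] (hp : IsGauge p) :
    0 < ∫ x, ‖x‖ ^ 2 * exp (-p x) := by
  rw [integral_pos_iff_support_of_nonneg (fun x => by positivity) hp.integrable_norm_sq_mul_exp_neg]
  have : Function.support (fun x => ‖x‖ ^ 2 * exp (-p x)) = {0}ᶜ := by
    ext x; simp
  rw [this]
  obtain ⟨x, hx⟩ := exists_ne (0 : E)
  exact isOpen_compl_singleton.measure_pos _ ⟨x, hx⟩

/-- Scaling of the weight in the integral of a homogeneous function. -/
lemma integral_mul_exp_neg_const_mul (hp : IsGauge p) {k : ℝ} (hk : 0 < k) (j : ℕ) {q : E → ℝ}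
    (hq : ∀ c : ℝ, 0 < c → ∀ x, q (c • x) = c ^ j * q x) :
    ∫ x, q x * exp (-(k * p x)) =
      (k ^ (Module.finrank ℝ E + j))⁻¹ * ∫ x, q x * exp (-p x) := by
  have h1 := Measure.integral_comp_smul (volume : Measure E) (fun x => q x * exp (-p x)) k
  have h2 : ∀ x, q (k • x) * exp (-p (k • x)) = k ^ j * (q x * exp (-(k * p x))) := fun x => by
    rw [hq k hk, hp.map_smul k hk.le]; ring
  simp only [h2] at h1
  rw [integral_const_mul, abs_of_pos (by positivity), smul_eq_mul] at h1
  rw [pow_add, mul_inv_rev, mul_assoc, ← h1]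
  field_simp

/-- The `e^{-p}`-mean of a gauge `p` is at most the dimension. -/
lemma integral_mul_exp_neg_le (hp : IsGauge p) :
    ∫ x, p x * exp (-p x) ≤ Module.finrank ℝ E * ∫ x, exp (-p x) := by
  set n := Module.finrank ℝ E
  set Z := ∫ x, exp (-p x)
  set P := ∫ x, p x * exp (-p x)
  have key : ∀ s : ℝ, 0 < s → s < 1 → s ^ n * P ≤ n * Z := fun s hs hs1 => by
    have h1 : Z + (1 - s) * P ≤ (s ^ n)⁻¹ * Z := by
      have h2 := hp.integral_mul_exp_neg_const_mul hs 0 (q := fun _ => 1) (by simp)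
      simp only [one_mul, add_zero] at h2
      rw [← h2, ← integral_const_mul,
        ← integral_add hp.integrable_exp_neg (hp.integrable_mul_exp_neg.const_mul _)]
      refine integral_mono (hp.integrable_exp_neg.add (hp.integrable_mul_exp_neg.const_mul _))
        (hp.const_mul hs).integrable_exp_neg fun x => ?_
      have h3 := add_one_le_exp ((1 - s) * p x)
      have h4 : exp (-(s * p x)) = exp ((1 - s) * p x) * exp (-p x) := by
        rw [← exp_add]; ring_nf
      simp only [h4]
      nlinarith [exp_pos (-p x)]
    have h5 : 1 - s ^ n ≤ n * (1 - s) := by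
      have := one_add_mul_le_pow (a := s - 1) (by linarith) n
      have h6 : 1 + (s - 1) = s := by ring
      rw [h6] at this
      linarith
    have hZ : 0 < Z := hp.integral_exp_neg_pos
    have hsn : 0 < s ^ n := by positivity
    have h7 : s ^ n * Z + (1 - s) * (s ^ n * P) ≤ Z := by
      calc _ = s ^ n * (Z + (1 - s) * P) := by ring
        _ ≤ s ^ n * ((s ^ n)⁻¹ * Z) := by gcongr
        _ = Z := by field_simp
    have h8 : (1 - s) * (s ^ n * P) ≤ (1 - s) * (n * Z) := by nlinarith
    exact le_of_mul_le_mul_left h8 (by linarith)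
  have hlim : Filter.Tendsto (fun s : ℝ => s ^ n * P) (nhdsWithin 1 (Set.Iio 1)) (nhds P) := by
    have : Filter.Tendsto (fun s : ℝ => s ^ n * P) (nhds 1) (nhds (1 ^ n * P)) :=
      Continuous.tendsto (by fun_prop) 1
    rw [one_pow, one_mul] at this
    exact this.mono_left nhdsWithin_le_nhds
  refine le_of_tendsto hlim ?_
  filter_upwards [Ioo_mem_nhdsLT (zero_lt_one (α := ℝ))] with s hs using key s hs.1 hs.2

/-- If the weight `e^{-p}` has barycentre at the origin, then `p (-u) ≤ n * p u` in dimension `n`,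
stated for linear minorants of `p`. -/
lemma neg_inner_le_of_barycenter (hp : IsGauge p) (hbar : ∀ v, ∫ x, ⟪v, x⟫ * exp (-p x) = 0)
    {y : E} (hy : ∀ x, ⟪y, x⟫ ≤ p x) (u : E) :
    -⟪y, u⟫ ≤ Module.finrank ℝ E * p u := by
  set n := Module.finrank ℝ E
  set Z := ∫ x, exp (-p x) with hZdef
  have hZ : 0 < Z := hp.integral_exp_neg_pos
  obtain ⟨M, hM, hMp⟩ := hp.exists_upper
  have hpn := hp.integral_mul_exp_neg_le
  have key : ∀ t : ℝ, 0 < t → t * (-⟪y, u⟫) ≤ n * (exp (t * p u) - 1) := fun t ht => by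
    have hcont : Continuous fun x => p (x + t • u) := hp.continuous.comp (by fun_prop)
    have hi1 : Integrable fun x => p (x + t • u) * exp (-p x) := by
      refine hp.integrable hcont (M * (1 + ‖t • u‖)) 1 fun x => ?_
      rw [abs_of_nonneg (hp.nonneg _), pow_one]
      calc p (x + t • u) ≤ M * ‖x + t • u‖ := hMp _
        _ ≤ M * (‖x‖ + ‖t • u‖) := by gcongr; exact norm_add_le _ _
        _ ≤ _ := by nlinarith [mul_nonneg hM.le (mul_nonneg (norm_nonneg (t • u)) (norm_nonneg x))]
    have hi2 := hp.integrable_exp_neg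
    have hi3 := hp.integrable_mul_exp_neg
    have hi4 := hp.integrable_inner_mul_exp_neg y
    -- Jensen: translating the argument of `p` does not decrease its mean.
    have h1 : ∫ x, p x * exp (-p x) ≤ ∫ x, p (x + t • u) * exp (-p x) := by
      have h2 : ∫ x, exp (-p (x + t • u)) = Z :=
        integral_add_right_eq_self (fun x => exp (-p x)) (t • u)
      have h3 : Z + (∫ x, p x * exp (-p x)) - (∫ x, p (x + t • u) * exp (-p x)) ≤
          ∫ x, exp (-p (x + t • u)) := by
        have hadd : Integrable fun x => exp (-p x) + p x * exp (-p x) := hi2.add hi3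
        rw [hZdef, ← integral_add hi2 hi3, ← integral_sub hadd hi1]
        refine integral_mono (hadd.sub hi1) (hi2.comp_add_right (t • u)) fun x => ?_
        have h4 := add_one_le_exp (p x - p (x + t • u))
        have h5 : exp (-p (x + t • u)) = exp (p x - p (x + t • u)) * exp (-p x) := by
          rw [← exp_add]; ring_nf
        simp only [h5]
        nlinarith [exp_pos (-p x)]
      linarith
    have h6 : ∫ x, (p x - ⟪y, x⟫) * exp (-p x) = ∫ x, p x * exp (-p x) := by
      simp only [sub_mul]
      rw [integral_sub hi3 hi4, hbar y, sub_zero]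
    have h7 : ∫ x, (p (x + t • u) - ⟪y, x + t • u⟫) * exp (-p (x + t • u)) =
        ∫ x, (p x - ⟪y, x⟫) * exp (-p x) :=
      integral_add_right_eq_self (fun x => (p x - ⟪y, x⟫) * exp (-p x)) (t • u)
    have hi5 : Integrable fun x => (p x - ⟪y, x⟫) * exp (-p x) := by
      simp only [sub_mul]; exact hi3.sub hi4
    have h8 : exp (-(t * p u)) *
        ((∫ x, p (x + t • u) * exp (-p x)) + t * (-⟪y, u⟫) * Z) ≤ ∫ x, p x * exp (-p x) := by
      have h9 : (∫ x, p (x + t • u) * exp (-p x)) + t * (-⟪y, u⟫) * Z =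
          ∫ x, (p (x + t • u) - ⟪y, x + t • u⟫) * exp (-p x) := by
        have : ∀ x, (p (x + t • u) - ⟪y, x + t • u⟫) * exp (-p x) =
            p (x + t • u) * exp (-p x) - ⟪y, x⟫ * exp (-p x) +
              t * (-⟪y, u⟫) * exp (-p x) := fun x => by
          rw [inner_add_right, real_inner_smul_right]; ring
        simp only [this]
        have hsub : Integrable fun x => p (x + t • u) * exp (-p x) - ⟪y, x⟫ * exp (-p x) :=
          hi1.sub hi4
        rw [integral_add hsub (hi2.const_mul _), integral_sub hi1 hi4, hbar y,
          integral_const_mul, sub_zero]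
      rw [h9, ← h6, ← h7, ← integral_const_mul]
      refine integral_mono_of_nonneg (Filter.Eventually.of_forall fun x => ?_)
        (hi5.comp_add_right (t • u)) (Filter.Eventually.of_forall fun x => ?_)
      · have := hy (x + t • u)
        exact mul_nonneg (exp_pos _).le (mul_nonneg (by linarith) (exp_pos _).le)
      · have h10 := hy (x + t • u)
        have h11 : exp (-(t * p u)) * exp (-p x) ≤ exp (-p (x + t • u)) := by
          rw [← exp_add]
          refine exp_le_exp.2 ?_
          have := hp.map_add_le x (t • u)
          rw [hp.map_smul t ht.le] at this
          linarith
        simp only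
        nlinarith
    have hP : n * Z * 1 ≥ ∫ x, p x * exp (-p x) := by linarith
    have h12 : exp (-(t * p u)) * exp (t * p u) = 1 := by rw [← exp_add]; simp
    have he := exp_pos (t * p u)
    have he1 : 1 ≤ exp (t * p u) := one_le_exp (mul_nonneg ht.le (hp.nonneg u))
    have h13 : (∫ x, p x * exp (-p x)) + t * (-⟪y, u⟫) * Z ≤
        exp (t * p u) * ∫ x, p x * exp (-p x) := by
      have := mul_le_mul_of_nonneg_left h8 he.le
      rw [← mul_assoc, mul_comm (exp (t * p u)), h12, one_mul] at this
      linarith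
    have h14 : t * (-⟪y, u⟫) * Z ≤ n * (exp (t * p u) - 1) * Z := by nlinarith
    exact le_of_mul_le_mul_right h14 hZ
  -- Let `t → 0`.
  by_contra! hcon
  rcases (hp.nonneg u).eq_or_lt with h0 | h0
  · have := key 1 one_pos
    rw [← h0] at this hcon
    simp at this hcon
    linarith
  have hder : HasDerivAt (fun t : ℝ => n * (exp (t * p u) - 1) - t * (-⟪y, u⟫))
      (n * (exp (0 * p u) * (1 * p u)) - 1 * (-⟪y, u⟫)) 0 :=
    ((((hasDerivAt_id (0 : ℝ)).mul_const (p u)).exp.sub_const 1).const_mul (n : ℝ)).sub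
      ((hasDerivAt_id (0 : ℝ)).mul_const _)
  have hneg : n * (exp (0 * p u) * (1 * p u)) - 1 * (-⟪y, u⟫) < 0 := by
    simp; linarith
  have hslope := hder.tendsto_slope.mono_left
    (nhdsWithin_mono (0 : ℝ) (s := Set.Ioi 0) (t := {0}ᶜ) fun _ hx => (Set.mem_Ioi.1 hx).ne')
  have hge := ge_of_tendsto hslope (b := 0) (by
    filter_upwards [self_mem_nhdsWithin] with t ht
    rw [slope_def_field]
    have := key t ht
    have h00 : (n : ℝ) * (exp (0 * p u) - 1) - 0 * (-⟪y, u⟫) = 0 := by simp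
    rw [h00]
    exact div_nonneg (by linarith) (by simpa using (le_of_lt ht)))
  linarith

end IsGauge

end Gauge

section Barycenter

variable {E : Type*} [NormedAddCommGroup E] [InnerProductSpace ℝ E] [FiniteDimensional ℝ E]
  [MeasurableSpace E] [BorelSpace E]

lemma exp_le_one_add_add_sq_mul_exp_abs (y : ℝ) : exp y ≤ 1 + y + y ^ 2 * exp |y| := by
  have h1 : exp y - 1 ≤ y * exp y := by
    have h2 := add_one_le_exp (-y)
    have h3 : exp (-y) * exp y = 1 := by rw [← exp_add]; simp
    nlinarith [exp_pos y]
  rcases le_total 0 y with hy | hy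
  · rw [abs_of_nonneg hy]
    nlinarith
  · have h4 := add_one_le_exp y
    have h5 : 1 ≤ exp |y| := one_le_exp (abs_nonneg y)
    nlinarith [mul_nonneg (sq_nonneg y) (sub_nonneg.2 h5)]

lemma IsGauge.integral_inner_nonneg_of_min {p : E → ℝ} (hp : IsGauge p) (v : E) {τ₀ : ℝ}
    (hτ₀ : 0 < τ₀) (hmin : ∀ τ : ℝ, 0 < τ → τ < τ₀ →
      ∫ x, exp (-p x) ≤ ∫ x, exp (-(p x - τ * ⟪v, x⟫))) :
    0 ≤ ∫ x, ⟪v, x⟫ * exp (-p x) := by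
  obtain ⟨m, hm, hmp⟩ := hp.exists_lower
  set A := ∫ x, ⟪v, x⟫ * exp (-p x)
  set C := ∫ x, ⟪v, x⟫ ^ 2 * exp (-(m / 2 * ‖x‖))
  have hg : IsGauge fun x : E => m / 2 * ‖x‖ := isGauge_mul_norm (by positivity)
  have hC : 0 ≤ C := integral_nonneg fun x => by positivity
  have key : ∀ τ : ℝ, 0 < τ → τ < τ₀ → τ * ‖v‖ ≤ m / 2 → 0 ≤ A + τ * C :=
    fun τ hτ hτ0 hτv => by
    have hi1 := hp.integrable_exp_neg
    have hi2 := (hp.integrable_inner_mul_exp_neg v).const_mul τ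
    have hi3 := (hg.integrable_inner_sq_mul_exp_neg v).const_mul (τ ^ 2)
    have hi12 : Integrable fun x => exp (-p x) + τ * (⟪v, x⟫ * exp (-p x)) := hi1.add hi2
    have h1 : ∫ x, exp (-(p x - τ * ⟪v, x⟫)) ≤
        (∫ x, exp (-p x)) + τ * A + τ ^ 2 * C := by
      rw [← integral_const_mul, ← integral_const_mul, ← integral_add hi1 hi2,
        ← integral_add hi12 hi3]
      refine integral_mono_of_nonneg (Filter.Eventually.of_forall fun x => (exp_pos _).le)
        (hi12.add hi3) (Filter.Eventually.of_forall fun x => ?_)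
      have h2 := exp_le_one_add_add_sq_mul_exp_abs (τ * ⟪v, x⟫)
      have h3 : exp (-(p x - τ * ⟪v, x⟫)) = exp (τ * ⟪v, x⟫) * exp (-p x) := by
        rw [← exp_add]; ring_nf
      have h4 : |τ * ⟪v, x⟫| ≤ m / 2 * ‖x‖ := by
        rw [abs_mul, abs_of_pos hτ]
        calc τ * |⟪v, x⟫| ≤ τ * (‖v‖ * ‖x‖) := by gcongr; exact abs_real_inner_le_norm v x
          _ = τ * ‖v‖ * ‖x‖ := by ring
          _ ≤ _ := by gcongr
      have h5 : exp |τ * ⟪v, x⟫| * exp (-p x) ≤ exp (-(m / 2 * ‖x‖)) := by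
        rw [← exp_add]
        exact exp_le_exp.2 (by linarith [hmp x])
      have h6 : (τ * ⟪v, x⟫) ^ 2 * (exp |τ * ⟪v, x⟫| * exp (-p x)) ≤
          (τ * ⟪v, x⟫) ^ 2 * exp (-(m / 2 * ‖x‖)) := by gcongr
      simp only [h3]
      nlinarith [mul_le_mul_of_nonneg_right h2 (exp_pos (-p x)).le]
    have h7 := hmin τ hτ hτ0
    have h8 : 0 ≤ τ * (A + τ * C) := by nlinarith
    exact nonneg_of_mul_nonneg_right h8 hτ
  by_contra! hA
  set τ := min (τ₀ / 2) (min (m / (2 * (‖v‖ + 1))) (-A / (2 * (C + 1)))) with hτdef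
  have hτ : 0 < τ := by
    refine lt_min (by positivity) (lt_min (by positivity) (div_pos (by linarith) (by positivity)))
  have hτ1 : τ ≤ τ₀ / 2 := min_le_left _ _
  have hτ2 : τ ≤ m / (2 * (‖v‖ + 1)) := (min_le_right _ _).trans (min_le_left _ _)
  have hτ3 : τ ≤ -A / (2 * (C + 1)) := (min_le_right _ _).trans (min_le_right _ _)
  rw [le_div_iff₀ (by positivity)] at hτ2 hτ3
  have := key τ hτ (by linarith) (by nlinarith)
  nlinarith

/-- First-order condition for the Laplace transform of `e^{-p}` to be minimal at the origin. -/
lemma IsGauge.integral_inner_eq_zero_of_min {p : E → ℝ} (hp : IsGauge p) {τ₀ : ℝ}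
    (hτ₀ : 0 < τ₀) (hmin : ∀ z : E, ‖z‖ < τ₀ →
      ∫ x, exp (-p x) ≤ ∫ x, exp (-(p x - ⟪z, x⟫))) (v : E) :
    ∫ x, ⟪v, x⟫ * exp (-p x) = 0 := by
  have key : ∀ v : E, 0 ≤ ∫ x, ⟪v, x⟫ * exp (-p x) := fun v => by
    refine hp.integral_inner_nonneg_of_min v (τ₀ := τ₀ / (‖v‖ + 1)) (by positivity)
      fun τ hτ hτ0 => ?_
    rw [lt_div_iff₀ (by positivity)] at hτ0
    have := hmin (τ • v) (by rw [norm_smul, Real.norm_of_nonneg hτ.le]; nlinarith)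
    simpa only [real_inner_smul_left] using this
  refine le_antisymm ?_ (key v)
  have := key (-v)
  simp only [inner_neg_left, neg_mul, integral_neg] at this
  linarith

lemma finrank_mul_integral_inner_sq_mul_exp_neg_norm {k : ℝ} (hk : 0 < k) (v : E) :
    Module.finrank ℝ E * ∫ x, ⟪v, x⟫ ^ 2 * exp (-(k * ‖x‖)) =
      ‖v‖ ^ 2 * ∫ x : E, ‖x‖ ^ 2 * exp (-(k * ‖x‖)) := by
  have hg : IsGauge fun x : E => k * ‖x‖ := isGauge_mul_norm hk
  have hrot : ∀ u w : E, ‖u‖ = ‖w‖ → ∫ x, ⟪u, x⟫ ^ 2 * exp (-(k * ‖x‖)) =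
      ∫ x, ⟪w, x⟫ ^ 2 * exp (-(k * ‖x‖)) := fun u w huw => by
    set R := (ℝ ∙ (u - w))ᗮ.reflection with hR
    have h1 : R u = w := Submodule.reflection_sub huw
    have h2 := R.measurePreserving.integral_comp R.toHomeomorph.measurableEmbedding
      (fun x => ⟪w, x⟫ ^ 2 * exp (-(k * ‖x‖)))
    rw [← h2]
    refine integral_congr_ae (Filter.Eventually.of_forall fun x => ?_)
    simp only [← h1, LinearIsometryEquiv.inner_map_map, LinearIsometryEquiv.norm_map]
  set b := stdOrthonormalBasis ℝ E
  have h3 : ∀ x : E, ‖v‖ ^ 2 * (‖x‖ ^ 2 * exp (-(k * ‖x‖))) =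
      ∑ i, ⟪‖v‖ • b i, x⟫ ^ 2 * exp (-(k * ‖x‖)) := fun x => by
    rw [← Finset.sum_mul, ← mul_assoc]
    congr 1
    simp only [real_inner_smul_left, mul_pow]
    rw [← Finset.mul_sum]
    congr 1
    have := b.sum_sq_norm_inner_right x
    rw [← this]
    exact Finset.sum_congr rfl fun i _ => by rw [Real.norm_eq_abs, sq_abs]
  rw [← integral_const_mul (‖v‖ ^ 2)]
  simp only [h3]
  rw [integral_finsetSum _ fun i _ => hg.integrable_inner_sq_mul_exp_neg _]
  have h4 : ∀ i, ∫ x, ⟪‖v‖ • b i, x⟫ ^ 2 * exp (-(k * ‖x‖)) =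
      ∫ x, ⟪v, x⟫ ^ 2 * exp (-(k * ‖x‖)) := fun i => hrot _ _ (by simp [norm_smul])
  simp [h4]

set_option maxHeartbeats 1000000 in
/-- Quantitative stability of the barycentre condition: `a` and `c = b + ⟪w, ·⟫` both have
barycentre at the origin and `b` is close to `a`, hence `w` is small. -/
theorem IsGauge.norm_sq_le_of_barycenter [Nontrivial E] {a b c : E → ℝ} (ha : IsGauge a)
    (hb : IsGauge b) (hc : IsGauge c) {w : E} (hcw : ∀ x, c x = b x + ⟪w, x⟫) {η κ m M : ℝ}
    (hn : 2 ≤ Module.finrank ℝ E) (hη1 : η < 1)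
    (hη : ∀ x, |b x - a x| ≤ η * a x) (hη0 : 0 ≤ η)
    (hκ : ∀ x, |b x - a x| ≤ κ * ‖x‖)
    (hca : ∀ x, c x ≤ (1 + η) * (Module.finrank ℝ E * a x))
    (hm : 0 < m) (hM : 0 < M) (hma : ∀ x, m * ‖x‖ ≤ a x) (haM : ∀ x, a x ≤ M * ‖x‖)
    (hbara : ∫ x, ⟪w, x⟫ * exp (-a x) = 0) (hbarc : ∫ x, ⟪w, x⟫ * exp (-c x) = 0) :
    ‖w‖ ^ 2 ≤ Module.finrank ℝ E * (M / m) ^ (Module.finrank ℝ E + 2) *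
      (κ * (((Module.finrank ℝ E : ℝ) ^ 2 - 1) *
        (((Module.finrank ℝ E + 2 : ℝ) / (Module.finrank ℝ E + 1)) * ((1 + η) / (1 - η))) ^
          (Module.finrank ℝ E + 2))) ^ 2 := by
  set N := Module.finrank ℝ E with hNdef
  obtain ⟨n, hnN⟩ : ∃ n : ℝ, n = N := ⟨_, rfl⟩
  have hn2 : (2 : ℝ) ≤ n := by rw [hnN]; exact_mod_cast hn
  rw [← hnN] at hca ⊢
  set t : ℝ := 1 / (n ^ 2 - 1) with ht
  set B : ℝ := (1 + η) * ((n + 2) / (n + 1)) with hB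
  have hn1 : 0 < n ^ 2 - 1 := by nlinarith
  have ht0 : 0 < t := by positivity
  have ht1 : t ≤ 1 := by rw [ht, div_le_one hn1]; nlinarith
  have hB0 : 0 < B := by positivity
  have hBt : (1 - t) * (1 + η) + t * ((1 + η) * n) = B := by
    rw [hB, ht]
    have : n + 1 ≠ 0 := by positivity
    have h2 : n ^ 2 - 1 ≠ 0 := hn1.ne'
    field_simp
    ring
  have h1η : 0 < 1 - η := by linarith
  set A := ∫ x, ⟪w, x⟫ ^ 2 * exp (-a x)
  set C := ∫ x, ‖x‖ ^ 2 * exp (-a x)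
  have hwq : ∀ s : ℝ, 0 < s → ∀ x, ⟪w, s • x⟫ ^ 2 = s ^ 2 * ⟪w, x⟫ ^ 2 := fun s _ x => by
    rw [real_inner_smul_right]; ring
  have hxq : ∀ s : ℝ, 0 < s → ∀ x : E, ‖s • x‖ ^ 2 = s ^ 2 * ‖x‖ ^ 2 := fun s hs x => by
    rw [norm_smul, Real.norm_of_nonneg hs.le]; ring
  have hib := hb.integrable_inner_mul_exp_neg w
  have hic := hc.integrable_inner_mul_exp_neg w
  have hia := ha.integrable_inner_mul_exp_neg w
  -- lower bound by strong convexity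
  have hlow : t * ((B ^ (N + 2))⁻¹ * A) ≤ ∫ x, ⟪w, x⟫ * exp (-b x) := by
    have h1 : ∫ x, (⟪w, x⟫ * exp (-b x) - ⟪w, x⟫ * exp (-c x)) =
        ∫ x, ⟪w, x⟫ * exp (-b x) := by rw [integral_sub hib hic, hbarc, sub_zero]
    rw [← h1, ← ha.integral_mul_exp_neg_const_mul hB0 2 hwq, ← integral_const_mul]
    refine integral_mono (((ha.const_mul hB0).integrable_inner_sq_mul_exp_neg w).const_mul t)
      (hib.sub hic) fun x => ?_
    have hbx : b x ≤ (1 + η) * a x := by linarith [(abs_le.1 (hη x)).2]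
    have hcx := hca x
    have hax := ha.nonneg x
    simp only
    rw [← mul_sub]
    rcases le_total 0 ⟪w, x⟫ with hl | hl
    · have h2 : B * a x ≥ b x + t * ⟪w, x⟫ := by
        have : b x + t * ⟪w, x⟫ = (1 - t) * b x + t * c x := by rw [hcw]; ring
        rw [this, ← hBt]
        nlinarith [mul_le_mul_of_nonneg_left hbx (sub_nonneg.2 ht1),
          mul_le_mul_of_nonneg_left hcx ht0.le]
      have h3 : exp (-(B * a x)) ≤ exp (-(b x + t * ⟪w, x⟫)) := exp_le_exp.2 (by linarith)
      have h4 : exp (-c x) ≤ exp (-(b x + t * ⟪w, x⟫)) := by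
        refine exp_le_exp.2 ?_
        rw [hcw]
        nlinarith
      have h5 := add_one_le_exp (t * ⟪w, x⟫)
      have h6 : exp (-b x) = exp (t * ⟪w, x⟫) * exp (-(b x + t * ⟪w, x⟫)) := by
        rw [← exp_add]; ring_nf
      have h7 : t * ⟪w, x⟫ * exp (-(B * a x)) ≤ exp (-b x) - exp (-c x) := by
        have h8 := mul_le_mul_of_nonneg_right h5 (exp_pos (-(b x + t * ⟪w, x⟫))).le
        have h9 := mul_le_mul_of_nonneg_left h3 (mul_nonneg ht0.le hl)
        linarith
      nlinarith [mul_le_mul_of_nonneg_left h7 hl]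
    · have h2 : exp (-(B * a x)) ≤ exp (-b x) := by
        refine exp_le_exp.2 ?_
        have h1n : (1 : ℝ) ≤ (n + 2) / (n + 1) := by
          rw [le_div_iff₀ (by positivity)]; linarith
        have : 1 + η ≤ B := le_mul_of_one_le_right (by linarith) h1n
        nlinarith
      have h5 := add_one_le_exp (-⟪w, x⟫)
      have h6 : exp (-c x) = exp (-⟪w, x⟫) * exp (-b x) := by
        rw [← exp_add, hcw]; ring_nf
      have h7 : -⟪w, x⟫ * exp (-(B * a x)) ≤ exp (-c x) - exp (-b x) := by
        have h8 := mul_le_mul_of_nonneg_right h5 (exp_pos (-b x)).le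
        have h9 := mul_le_mul_of_nonneg_left h2 (neg_nonneg.2 hl)
        linarith
      have h8 := mul_le_mul_of_nonneg_left h7 (neg_nonneg.2 hl)
      have h9 : t * (⟪w, x⟫ ^ 2 * exp (-(B * a x))) ≤ 1 * (⟪w, x⟫ ^ 2 * exp (-(B * a x))) := by
        gcongr
      nlinarith
  -- upper bound by comparison of the weights
  have hupp : ∀ σ : ℝ, 0 < σ → ∫ x, ⟪w, x⟫ * exp (-b x) ≤
      ((1 - η) ^ (N + 2))⁻¹ * (σ * A + κ ^ 2 / (4 * σ) * C) := fun σ hσ => by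
    have h1 : ∫ x, (⟪w, x⟫ * exp (-b x) - ⟪w, x⟫ * exp (-a x)) =
        ∫ x, ⟪w, x⟫ * exp (-b x) := by rw [integral_sub hib hia, hbara, sub_zero]
    have hg := ha.const_mul h1η
    have hi1 := (hg.integrable_inner_sq_mul_exp_neg w).const_mul σ
    have hi2 := (hg.integrable_norm_sq_mul_exp_neg).const_mul (κ ^ 2 / (4 * σ))
    rw [← h1, mul_add, mul_left_comm, mul_left_comm _ (κ ^ 2 / (4 * σ)),
      ← ha.integral_mul_exp_neg_const_mul h1η 2 hwq,
      ← ha.integral_mul_exp_neg_const_mul h1η 2 (q := fun x => ‖x‖ ^ 2) hxq,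
      ← integral_const_mul, ← integral_const_mul, ← integral_add hi1 hi2]
    refine integral_mono (hib.sub hia) (hi1.add hi2) fun x => ?_
    have hax := ha.nonneg x
    have hbx := abs_le.1 (hη x)
    have hd : |exp (-b x) - exp (-a x)| ≤ κ * ‖x‖ * exp (-((1 - η) * a x)) := by
      have h2 : |exp (-b x) - exp (-a x)| ≤ |b x - a x| * exp (-((1 - η) * a x)) := by
        have e1 : exp (-b x) ≤ exp (-((1 - η) * a x)) := exp_le_exp.2 (by linarith)
        have e2 : exp (-a x) ≤ exp (-((1 - η) * a x)) := exp_le_exp.2 (by nlinarith)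
        have e3 := add_one_le_exp (b x - a x)
        have e4 := add_one_le_exp (a x - b x)
        have e5 : exp (-a x) = exp (b x - a x) * exp (-b x) := by rw [← exp_add]; ring_nf
        have e6 : exp (-b x) = exp (a x - b x) * exp (-a x) := by rw [← exp_add]; ring_nf
        have e7 := mul_le_mul_of_nonneg_right e3 (exp_pos (-b x)).le
        have e8 := mul_le_mul_of_nonneg_right e4 (exp_pos (-a x)).le
        rcases le_total (a x) (b x) with h | h
        · rw [abs_of_nonneg (sub_nonneg.2 h), abs_le]
          have := mul_le_mul_of_nonneg_left e2 (sub_nonneg.2 h)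
          have hmono : exp (-b x) ≤ exp (-a x) := exp_le_exp.2 (by linarith)
          have := mul_nonneg (sub_nonneg.2 h) (exp_pos (-((1 - η) * a x))).le
          constructor <;> linarith
        · rw [abs_of_nonpos (sub_nonpos.2 h), abs_le]
          have := mul_le_mul_of_nonneg_left e1 (sub_nonneg.2 h)
          have hmono : exp (-a x) ≤ exp (-b x) := exp_le_exp.2 (by linarith)
          have := mul_nonneg (sub_nonneg.2 h) (exp_pos (-((1 - η) * a x))).le
          constructor <;> linarith
      exact h2.trans (by gcongr; exact hκ x)
    simp only
    rw [← mul_sub]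
    have h3 : |⟪w, x⟫| * (κ * ‖x‖) ≤ σ * ⟪w, x⟫ ^ 2 + κ ^ 2 / (4 * σ) * ‖x‖ ^ 2 := by
      have : σ * ⟪w, x⟫ ^ 2 + κ ^ 2 / (4 * σ) * ‖x‖ ^ 2 - |⟪w, x⟫| * (κ * ‖x‖) =
          (2 * σ * |⟪w, x⟫| - κ * ‖x‖) ^ 2 / (4 * σ) := by
        rw [← sq_abs ⟪w, x⟫]; field_simp; ring
      have h4 : 0 ≤ (2 * σ * |⟪w, x⟫| - κ * ‖x‖) ^ 2 / (4 * σ) := by positivity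
      linarith
    calc ⟪w, x⟫ * (exp (-b x) - exp (-a x)) ≤ |⟪w, x⟫| * |exp (-b x) - exp (-a x)| := by
          rw [← abs_mul]; exact le_abs_self _
      _ ≤ |⟪w, x⟫| * (κ * ‖x‖ * exp (-((1 - η) * a x))) := by gcongr
      _ = |⟪w, x⟫| * (κ * ‖x‖) * exp (-((1 - η) * a x)) := by ring
      _ ≤ (σ * ⟪w, x⟫ ^ 2 + κ ^ 2 / (4 * σ) * ‖x‖ ^ 2) * exp (-((1 - η) * a x)) := by gcongr
      _ = _ := by ring
  set G := (n ^ 2 - 1) * ((n + 2) / (n + 1) * ((1 + η) / (1 - η))) ^ (N + 2) with hG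
  have hG0 : 0 < G := by positivity
  have hAC : A ≤ (κ * G) ^ 2 * C := by
    have hP : 0 < (1 - η) ^ (N + 2) := by positivity
    have hGρ : t * (B ^ (N + 2))⁻¹ * (1 - η) ^ (N + 2) = G⁻¹ := by
      have : (n + 2) / (n + 1) * ((1 + η) / (1 - η)) = B / (1 - η) := by rw [hB]; ring
      rw [hG, this, div_pow, ht]
      field_simp
    have h1 := hlow.trans (hupp (G⁻¹ / 2) (by positivity))
    have h2 := mul_le_mul_of_nonneg_left h1 hP.le
    rw [mul_inv_cancel_left₀ hP.ne'] at h2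
    have h3 : (1 - η) ^ (N + 2) * (t * ((B ^ (N + 2))⁻¹ * A)) = G⁻¹ * A := by
      rw [← hGρ]; ring
    rw [h3] at h2
    have h4 : κ ^ 2 / (4 * (G⁻¹ / 2)) * C = G⁻¹ / 2 * ((κ * G) ^ 2 * C) := by
      field_simp; ring
    rw [h4] at h2
    have h5 : G⁻¹ / 2 * A ≤ G⁻¹ / 2 * ((κ * G) ^ 2 * C) := by linarith
    exact le_of_mul_le_mul_left h5 (by positivity)
  have hg1 : IsGauge fun x : E => ‖x‖ := by simpa using isGauge_mul_norm (E := E) one_pos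
  set I := ∫ x : E, ‖x‖ ^ 2 * exp (-‖x‖)
  have hI : 0 < I := hg1.integral_norm_sq_mul_exp_neg_pos
  have hAlow : ‖w‖ ^ 2 * ((M ^ (N + 2))⁻¹ * I) ≤ n * A := by
    have h1 := hg1.integral_mul_exp_neg_const_mul hM 2 (q := fun x => ‖x‖ ^ 2) hxq
    rw [← h1, ← finrank_mul_integral_inner_sq_mul_exp_neg_norm hM w, ← hNdef, ← hnN]
    refine mul_le_mul_of_nonneg_left (integral_mono
      ((isGauge_mul_norm hM).integrable_inner_sq_mul_exp_neg w)
      (ha.integrable_inner_sq_mul_exp_neg w) fun x => ?_) (by linarith)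
    have := haM x
    simp only
    gcongr
  have hCupp : C ≤ (m ^ (N + 2))⁻¹ * I := by
    have h1 := hg1.integral_mul_exp_neg_const_mul hm 2 (q := fun x => ‖x‖ ^ 2) hxq
    rw [← h1]
    refine integral_mono ha.integrable_norm_sq_mul_exp_neg
      (isGauge_mul_norm hm).integrable_norm_sq_mul_exp_neg fun x => ?_
    have := hma x
    simp only
    gcongr
  have hfin : ‖w‖ ^ 2 * ((M ^ (N + 2))⁻¹ * I) ≤
      (n * (M / m) ^ (N + 2) * (κ * G) ^ 2) * ((M ^ (N + 2))⁻¹ * I) := by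
    calc _ ≤ n * A := hAlow
      _ ≤ n * ((κ * G) ^ 2 * ((m ^ (N + 2))⁻¹ * I)) := by
        have := hAC.trans (mul_le_mul_of_nonneg_left hCupp (sq_nonneg (κ * G)))
        gcongr
      _ = _ := by rw [div_pow]; field_simp
  exact le_of_mul_le_mul_right hfin (by positivity)

end Barycenter

section SupportFunction

variable {E : Type*} [NormedAddCommGroup E] [InnerProductSpace ℝ E]

/-- The support function of a set. -/
noncomputable def supportFun (K : Set E) (x : E) : ℝ := sSup ((fun y => ⟪y, x⟫) '' K)

lemma inner_le_supportFun {K : Set E} (hK : IsCompact K) {y : E} (hy : y ∈ K) (x : E) :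
    ⟪y, x⟫ ≤ supportFun K x :=
  le_csSup (hK.image (by fun_prop)).bddAbove ⟨y, hy, rfl⟩

lemma supportFun_le {K : Set E} (hne : K.Nonempty) {x : E} {r : ℝ} (h : ∀ y ∈ K, ⟪y, x⟫ ≤ r) :
    supportFun K x ≤ r :=
  csSup_le (hne.image _) (by rintro _ ⟨y, hy, rfl⟩; exact h y hy)

lemma supportFun_add_neg_le {K : Set E} (hne : K.Nonempty) {D : ℝ}
    (hD : ∀ y ∈ K, ∀ y' ∈ K, ‖y - y'‖ ≤ D) (x : E) :
    supportFun K x + supportFun K (-x) ≤ D * ‖x‖ := by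
  have key : ∀ y ∈ K, supportFun K (-x) ≤ D * ‖x‖ - ⟪y, x⟫ := fun y hy => by
    refine supportFun_le hne fun y' hy' => ?_
    have h1 := (real_inner_le_norm (y - y') x).trans
      (mul_le_mul_of_nonneg_right (hD y hy y' hy') (norm_nonneg x))
    rw [inner_sub_left] at h1
    rw [inner_neg_right]
    linarith
  have : supportFun K x ≤ D * ‖x‖ - supportFun K (-x) :=
    supportFun_le hne fun y hy => by linarith [key y hy]
  linarith

lemma isGauge_supportFun_sub {K : Set E} (hK : IsCompact K) (hne : K.Nonempty) {z : E} {m : ℝ}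
    (hm : 0 < m) (h : ∀ x, m * ‖x‖ ≤ supportFun K x - ⟪z, x⟫) :
    IsGauge fun x => supportFun K x - ⟪z, x⟫ where
  map_smul c hc x := by
    have h1 : (fun y => ⟪y, c • x⟫) '' K = c • ((fun y => ⟪y, x⟫) '' K) := by
      rw [← Set.image_smul, Set.image_image]
      simp only [real_inner_smul_right, smul_eq_mul]
    have h2 : supportFun K (c • x) = c * supportFun K x := by
      rw [supportFun, h1, Real.sSup_smul_of_nonneg hc, smul_eq_mul, supportFun]
    rw [h2, real_inner_smul_right]
    ring
  map_add_le x y := by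
    have : supportFun K (x + y) ≤ supportFun K x + supportFun K y :=
      supportFun_le hne fun k hk => by
        rw [inner_add_right]
        exact add_le_add (inner_le_supportFun hK hk x) (inner_le_supportFun hK hk y)
    rw [inner_add_right]
    linarith
  exists_lower := ⟨m, hm, h⟩
  exists_upper := by
    obtain ⟨R, hR, hKR⟩ := hK.isBounded.exists_pos_norm_le
    refine ⟨R + ‖z‖, by positivity, fun x => ?_⟩
    have h1 : supportFun K x ≤ R * ‖x‖ := supportFun_le hne fun y hy =>
      (real_inner_le_norm y x).trans (by gcongr; exact hKR y hy)
    have h2 := neg_le_of_abs_le (abs_real_inner_le_norm z x)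
    linarith

lemma isGauge_supportFun_sub_of_mem_interior {K : Set E} (hK : IsCompact K) {z : E}
    (hz : z ∈ interior K) : IsGauge fun x => supportFun K x - ⟪z, x⟫ := by
  obtain ⟨r, hr, hball⟩ := Metric.isOpen_iff.1 isOpen_interior z hz
  refine isGauge_supportFun_sub hK ⟨z, interior_subset hz⟩ (half_pos hr) fun x => ?_
  rcases eq_or_ne x 0 with rfl | hx
  · simpa using inner_le_supportFun hK (interior_subset hz) 0
  have hx0 : 0 < ‖x‖ := norm_pos_iff.2 hx
  have hmem : z + (r / 2 / ‖x‖) • x ∈ K := by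
    refine interior_subset (hball ?_)
    rw [Metric.mem_ball, dist_eq_norm, add_sub_cancel_left, norm_smul,
      Real.norm_of_nonneg (by positivity), div_mul_cancel₀ _ hx0.ne']
    linarith
  have := inner_le_supportFun hK hmem x
  rw [inner_add_left, real_inner_smul_left, real_inner_self_eq_norm_sq] at this
  have h2 : r / 2 / ‖x‖ * ‖x‖ ^ 2 = r / 2 * ‖x‖ := by field_simp
  linarith

variable [FiniteDimensional ℝ E] [MeasurableSpace E] [BorelSpace E]

/-- Comparing sublevel sets of gauges compares the integrals of `e^{-p}`. -/
lemma IsGauge.integral_exp_neg_le {p q : E → ℝ} (hp : IsGauge p) (hq : IsGauge q)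
    (h : volume {x | p x ≤ 1} ≤ volume {x | q x ≤ 1}) :
    ∫ x, exp (-p x) ≤ ∫ x, exp (-q x) := by
  have hzero : ∀ {p : E → ℝ}, IsGauge p → p 0 = 0 := fun hp => by
    simpa using hp.map_smul 0 le_rfl 0
  have hscale : ∀ {p : E → ℝ}, IsGauge p → ∀ r : ℝ, 0 < r →
      {x | p x ≤ r} = r • {x | p x ≤ 1} := fun hp r hr => by
    ext x
    rw [Set.mem_smul_set_iff_inv_smul_mem₀ hr.ne', Set.mem_ofPred_eq, Set.mem_ofPred_eq,
      hp.map_smul _ (inv_nonneg.2 hr.le), inv_mul_le_iff₀ hr, mul_one]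
  have hlevel : ∀ r : ℝ, volume {x | p x ≤ r} ≤ volume {x | q x ≤ r} := fun r => by
    rcases lt_or_ge 0 r with hr | hr
    · rw [hscale hp r hr, hscale hq r hr, Measure.addHaar_smul, Measure.addHaar_smul]
      gcongr
    · refine measure_mono fun x hx => ?_
      obtain ⟨m, hm, hmp⟩ := hp.exists_lower
      have hx' : p x ≤ r := hx
      have hx0 : x = 0 := by
        have : m * ‖x‖ ≤ 0 := (hmp x).trans (hx'.trans hr)
        rw [← norm_le_zero_iff]
        exact nonpos_of_mul_nonpos_right this hm
      subst hx0
      rw [hzero hp] at hx'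
      exact (hzero hq).trans_le hx'
  have hlay : ∀ {p : E → ℝ}, IsGauge p → ∫⁻ x, ENNReal.ofReal (exp (-p x)) =
      ∫⁻ t in Set.Ioi (0 : ℝ), volume {x | p x ≤ -log t} := fun {p} hp => by
    rw [lintegral_eq_lintegral_meas_le (f := fun x => exp (-p x)) _ (Filter.Eventually.of_forall fun x => (exp_pos _).le)
      (continuous_exp.comp hp.continuous.neg).aemeasurable]
    refine setLIntegral_congr_fun measurableSet_Ioi fun t ht => ?_
    congr 1
    ext x
    simp only [Set.mem_ofPred_eq]
    rw [← Real.log_le_iff_le_exp ht]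
    constructor <;> intro h <;> linarith
  have h1 : ENNReal.ofReal (∫ x, exp (-p x)) ≤ ENNReal.ofReal (∫ x, exp (-q x)) := by
    rw [ofReal_integral_eq_lintegral_ofReal hp.integrable_exp_neg
        (Filter.Eventually.of_forall fun x => (exp_pos _).le),
      ofReal_integral_eq_lintegral_ofReal hq.integrable_exp_neg
        (Filter.Eventually.of_forall fun x => (exp_pos _).le), hlay hp, hlay hq]
    exact lintegral_mono fun t => hlevel _
  exact (ENNReal.ofReal_le_ofReal_iff hq.integral_exp_neg_pos.le).1 h1

lemma IsGauge.volume_setOf_le_one_ne_top {p : E → ℝ} (hp : IsGauge p) :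
    volume {x | p x ≤ 1} ≠ ⊤ := by
  obtain ⟨m, hm, hmp⟩ := hp.exists_lower
  refine ne_top_of_le_ne_top (measure_closedBall_lt_top (x := (0 : E)) (r := 1 / m)).ne
    (measure_mono fun x hx => ?_)
  rw [mem_closedBall_zero_iff, le_div_iff₀ hm]
  have : p x ≤ 1 := hx
  linarith [hmp x]

/-- A body of diameter `D` and width `w` in some direction lies in a box of sides `w, D, …, D`. -/
lemma volume_le_width_mul_pow {K : Set E} (hK : IsCompact K) (hne : K.Nonempty) {D : ℝ}
    (hD : ∀ y ∈ K, ∀ y' ∈ K, ‖y - y'‖ ≤ D) {u : E} (hu : ‖u‖ = 1) :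
    (volume K).toReal ≤
      (supportFun K u + supportFun K (-u)) * D ^ (Module.finrank ℝ E - 1) := by
  obtain ⟨n, hn⟩ : ∃ n, Module.finrank ℝ E = n + 1 := by
    have : Nontrivial E := ⟨u, 0, fun h => by simp [h] at hu⟩
    exact ⟨_, (Nat.succ_pred_eq_of_pos Module.finrank_pos).symm⟩
  obtain ⟨b, hb⟩ := Orthonormal.exists_orthonormalBasis_extension_of_card_eq (𝕜 := ℝ) (E := E)
    (ι := Fin (n + 1)) (by simpa using hn) (v := fun _ => u) (s := {0})
    ⟨fun _ => hu, fun i j hij => (hij (Subsingleton.elim i j)).elim⟩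
  have hb0 : b 0 = u := hb 0 rfl
  set hi : Fin (n + 1) → ℝ := fun i => supportFun K (b i)
  set lo : Fin (n + 1) → ℝ := fun i => -supportFun K (-b i)
  have hmp := (PiLp.volume_preserving_ofLp (Fin (n + 1))).comp b.measurePreserving_repr
  have hsub : K ⊆ (WithLp.ofLp ∘ b.repr) ⁻¹' Set.Icc lo hi := fun y hy => by
    refine ⟨fun i => ?_, fun i => ?_⟩
    · have := inner_le_supportFun hK hy (-b i)
      rw [inner_neg_right, real_inner_comm] at this
      simp only [Function.comp_apply, lo, b.repr_apply_apply]
      linarith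
    · have := inner_le_supportFun hK hy (b i)
      rw [real_inner_comm] at this
      simpa only [Function.comp_apply, hi, b.repr_apply_apply] using this
  obtain ⟨y, hy⟩ := hne
  have hle : lo ≤ hi := fun i => ((hsub hy).1 i).trans ((hsub hy).2 i)
  have hvol : volume K ≤ volume (Set.Icc lo hi) := by
    rw [← hmp.measure_preimage measurableSet_Icc.nullMeasurableSet]
    exact measure_mono hsub
  have hfin : volume (Set.Icc lo hi) ≠ ⊤ := isCompact_Icc.measure_lt_top.ne
  have h1 := ENNReal.toReal_mono hfin hvol
  rw [Real.volume_Icc_pi_toReal hle, Fin.prod_univ_succ] at h1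
  refine h1.trans ?_
  have h2 : hi 0 - lo 0 = supportFun K u + supportFun K (-u) := by
    simp only [hi, lo, hb0]; ring
  rw [h2, hn, Nat.add_sub_cancel]
  have h3 : 0 ≤ supportFun K u + supportFun K (-u) := by
    rw [← h2]; linarith [hle 0]
  refine mul_le_mul_of_nonneg_left ?_ h3
  calc ∏ i : Fin n, (hi i.succ - lo i.succ) ≤ ∏ _i : Fin n, D := by
        refine Finset.prod_le_prod (fun i _ => sub_nonneg.2 (hle _)) fun i _ => ?_
        have := supportFun_add_neg_le ⟨y, hy⟩ hD (b i.succ)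
        rw [b.norm_eq_one, mul_one] at this
        simp only [hi, lo]
        linarith
    _ = D ^ n := by simp

end SupportFunction

section Santalo

variable {d : ℕ}

lemma polarBody_image_sub {K : Set (EuclideanSpace ℝ (Fin d))} (hK : IsCompact K)
    (hne : K.Nonempty) (z : EuclideanSpace ℝ (Fin d)) :
    polarBody ((· - z) '' K) = {x | supportFun K x - ⟪z, x⟫ ≤ 1} := by
  ext x
  simp only [polarBody, Set.forall_mem_image, Set.mem_ofPred_eq, inner_sub_right]
  constructor
  · intro h
    have : supportFun K x ≤ 1 + ⟪z, x⟫ := supportFun_le hne fun y hy => by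
      rw [real_inner_comm x y, real_inner_comm x z]
      linarith [h hy]
    linarith
  · intro h y hy
    have := inner_le_supportFun hK hy x
    rw [real_inner_comm y x, real_inner_comm z x]
    linarith

/-- The weight `e^{-(h_K - ⟪s, ·⟫)}` has barycentre at the origin if `s` is the Santaló point. -/
lemma IsSantaloPoint.integral_inner_eq_zero {K : Set (EuclideanSpace ℝ (Fin d))}
    (hK : IsCompact K) {s : EuclideanSpace ℝ (Fin d)} (hs : IsSantaloPoint K s)
    (v : EuclideanSpace ℝ (Fin d)) :
    ∫ x, ⟪v, x⟫ * exp (-(supportFun K x - ⟪s, x⟫)) = 0 := by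
  have hne : K.Nonempty := ⟨s, interior_subset hs.1⟩
  have hp := isGauge_supportFun_sub_of_mem_interior hK hs.1
  obtain ⟨r, hr, hball⟩ := Metric.isOpen_iff.1 isOpen_interior s hs.1
  refine hp.integral_inner_eq_zero_of_min hr (fun z hz => ?_) v
  have hmem : s + z ∈ interior K := hball (by simpa using hz)
  have hq := isGauge_supportFun_sub_of_mem_interior hK hmem
  have h1 := hs.2 _ hmem
  rw [polarBody_image_sub hK hne, polarBody_image_sub hK hne, vol, vol,
    ENNReal.toReal_le_toReal hp.volume_setOf_le_one_ne_top hq.volume_setOf_le_one_ne_top] at h1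
  have h2 := hp.integral_exp_neg_le hq h1
  simpa only [inner_add_left, sub_sub] using h2

/-- Minkowski's asymmetry bound at the Santaló point. -/
lemma IsSantaloPoint.supportFun_neg_le {K : Set (EuclideanSpace ℝ (Fin d))}
    (hK : IsCompact K) {s : EuclideanSpace ℝ (Fin d)} (hs : IsSantaloPoint K s)
    (x : EuclideanSpace ℝ (Fin d)) :
    supportFun K (-x) - ⟪s, -x⟫ ≤ d * (supportFun K x - ⟪s, x⟫) := by
  have hne : K.Nonempty := ⟨s, interior_subset hs.1⟩
  have hp := isGauge_supportFun_sub_of_mem_interior hK hs.1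
  have : supportFun K (-x) ≤ ⟪s, -x⟫ + d * (supportFun K x - ⟪s, x⟫) :=
    supportFun_le hne fun y hy => by
      have h1 := hp.neg_inner_le_of_barycenter (fun v => hs.integral_inner_eq_zero hK v)
        (y := y - s) (fun x => by
          rw [inner_sub_left]; linarith [inner_le_supportFun hK hy x]) x
      rw [finrank_euclideanSpace_fin, inner_sub_left] at h1
      rw [inner_neg_right, inner_neg_right]
      linarith
  linarith

end Santalo

section Constants

lemma unitBallVol_eq {m : ℕ} (hm : 1 ≤ m) :
    unitBallVol m = √π ^ m / Gamma (m / 2 + 1) := by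
  have : Nonempty (Fin m) := ⟨⟨0, hm⟩⟩
  have hG : 0 < Gamma ((m : ℝ) / 2 + 1) := Gamma_pos_of_pos (by positivity)
  rw [unitBallVol, EuclideanSpace.volume_ball]
  simp only [ENNReal.ofReal_one, one_pow, one_mul, Fintype.card_fin]
  exact ENNReal.toReal_ofReal (by positivity)

lemma unitBallVol_pos {m : ℕ} (hm : 1 ≤ m) : 0 < unitBallVol m := by
  rw [unitBallVol_eq hm]
  have hG : 0 < Gamma ((m : ℝ) / 2 + 1) := Gamma_pos_of_pos (by positivity)
  positivity

lemma sq_mul_unitBallVol_div_ge {d : ℕ} (hd : 2 ≤ d) :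
    6 * (d : ℝ) ^ 2 / (d + 1) ≤ (d * unitBallVol d / unitBallVol (d - 1)) ^ 2 := by
  obtain ⟨m, rfl⟩ : ∃ m, d = m + 1 := ⟨d - 1, by omega⟩
  have hm : 1 ≤ m := by omega
  rw [Nat.add_sub_cancel, unitBallVol_eq hm, unitBallVol_eq (by omega : 1 ≤ m + 1)]
  set g := Gamma ((m : ℝ) / 2 + 1) with hg
  set g' := Gamma (((m + 1 : ℕ) : ℝ) / 2 + 1) with hg'
  have hgp : 0 < g := Gamma_pos_of_pos (by positivity)
  have hgp' : 0 < g' := Gamma_pos_of_pos (by positivity)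
  have hkey : g' ^ 2 ≤ g ^ 2 * ((m : ℝ) / 2 + 1) := by
    have h1 := Gamma_mul_add_mul_le_rpow_Gamma_mul_rpow_Gamma (s := (m : ℝ) / 2 + 1)
      (t := (m : ℝ) / 2 + 1 + 1) (a := 1 / 2) (b := 1 / 2) (by positivity) (by positivity)
      (by norm_num) (by norm_num) (by norm_num)
    have h2 : 1 / 2 * ((m : ℝ) / 2 + 1) + 1 / 2 * ((m : ℝ) / 2 + 1 + 1) =
        ((m + 1 : ℕ) : ℝ) / 2 + 1 := by push_cast; ring
    rw [h2, ← hg', Gamma_add_one (s := (m : ℝ) / 2 + 1) (by positivity), ← hg, ← sqrt_eq_rpow, ← sqrt_eq_rpow,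
      ← sqrt_mul hgp.le] at h1
    have h3 := (Real.le_sqrt hgp'.le (by positivity)).1 h1
    linarith
  have hpi : √π ^ 2 = π := sq_sqrt pi_pos.le
  have hs : 0 < √π := sqrt_pos.2 pi_pos
  have hval : ((m + 1 : ℕ) : ℝ) * (√π ^ (m + 1) / g') / (√π ^ m / g) =
      ((m + 1 : ℕ) : ℝ) * √π * g / g' := by
    rw [pow_succ]; field_simp
  rw [hval, div_pow, mul_pow, mul_pow, hpi, le_div_iff₀ (by positivity), div_mul_eq_mul_div,
    div_le_iff₀ (by positivity)]
  have hpi3 := pi_gt_three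
  push_cast
  have h4 : 3 * (2 * g' ^ 2) ≤ π * (g ^ 2 * (m + 2)) := by
    have : 0 ≤ g ^ 2 * ((m : ℝ) + 2) := by positivity
    nlinarith
  nlinarith [mul_le_mul_of_nonneg_left h4 (sq_nonneg ((m : ℝ) + 1))]

lemma two_le_mul_unitBallVol_div {d : ℕ} (hd : 2 ≤ d) :
    2 ≤ d * unitBallVol d / unitBallVol (d - 1) := by
  have h1 := sq_mul_unitBallVol_div_ge hd
  have hd' : (2 : ℝ) ≤ d := by exact_mod_cast hd
  have h2 : (4 : ℝ) ≤ 6 * (d : ℝ) ^ 2 / (d + 1) := by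
    rw [le_div_iff₀ (by positivity)]; nlinarith
  have h3 : 0 ≤ d * unitBallVol d / unitBallVol (d - 1) := by
    have := unitBallVol_pos (by omega : 1 ≤ d)
    have := unitBallVol_pos (by omega : 1 ≤ d - 1)
    positivity
  nlinarith

lemma sq_sub_one_sq_mul_le {d : ℕ} (hd : 2 ≤ d) :
    ((d : ℝ) ^ 2 - 1) ^ 2 * 288 ≤ d * 6 ^ (d + 2) := by
  induction d, hd using Nat.le_induction with
  | base => norm_num
  | succ n hn ih =>
    have hn' : (2 : ℝ) ≤ n := by exact_mod_cast hn
    push_cast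
    have h1 : (((n : ℝ) + 1) ^ 2 - 1) ^ 2 * n ≤ 6 * ((n : ℝ) ^ 2 - 1) ^ 2 * (n + 1) := by
      obtain ⟨k, hk⟩ : ∃ k : ℝ, k = n - 2 := ⟨_, rfl⟩
      have hk0 : 0 ≤ k := by linarith
      have hnk : (n : ℝ) = k + 2 := by linarith
      rw [hnk]
      have : 6 * ((k + 2) ^ 2 - 1) ^ 2 * (k + 2 + 1) - (((k + 2) + 1) ^ 2 - 1) ^ 2 * (k + 2) =
          5 * k ^ 5 + 52 * k ^ 4 + 200 * k ^ 3 + 340 * k ^ 2 + 230 * k + 34 := by ring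
      have : 0 ≤ 5 * k ^ 5 + 52 * k ^ 4 + 200 * k ^ 3 + 340 * k ^ 2 + 230 * k + 34 := by positivity
      linarith
    have h2 : (((n : ℝ) + 1) ^ 2 - 1) ^ 2 * 288 * n ≤ (n + 1) * 6 ^ (n + 1 + 2) * n := by
      have h3 := mul_le_mul_of_nonneg_right ih (by positivity : (0 : ℝ) ≤ 6 * (n + 1))
      rw [show (6 : ℝ) ^ (n + 1 + 2) = 6 ^ (n + 2) * 6 by ring]
      nlinarith
    exact le_of_mul_le_mul_right h2 (by linarith)

lemma add_one_mul_add_two_le {d : ℕ} (hd : 2 ≤ d) :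
    ((d : ℝ) + 1) * (d + 2) * 16 ≤ 3 * (2 * 2 ^ (2 * d + 1)) := by
  induction d, hd using Nat.le_induction with
  | base => norm_num
  | succ n hn ih =>
    have hn' : (2 : ℝ) ≤ n := by exact_mod_cast hn
    push_cast
    rw [show (2 : ℝ) ^ (2 * (n + 1) + 1) = 2 ^ (2 * n + 1) * 4 by ring]
    nlinarith

/-- The numerical inequality absorbing the constants of the stability estimate. -/
lemma stability_constant_le {d : ℕ} (hd : 2 ≤ d) {η : ℝ} (hη0 : 0 ≤ η)
    (hη : η * (2 * 2 ^ (2 * d + 1)) ≤ d + 1) :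
    (((d : ℝ) ^ 2 - 1) * (((d + 2 : ℝ) / (d + 1)) * ((1 + η) / (1 - η))) ^ (d + 2)) ^ 2 ≤
      d * (6 * d / (d + 1)) ^ (d + 2) := by
  have hd' : (2 : ℝ) ≤ d := by exact_mod_cast hd
  have h1 : (d + 2) * η ≤ 3 / 16 := by
    have h2 := add_one_mul_add_two_le hd
    have h3 : (0 : ℝ) < 2 * 2 ^ (2 * d + 1) := by positivity
    have h4 : ((d + 2) * η) * (2 * 2 ^ (2 * d + 1)) ≤ 3 / 16 * (2 * 2 ^ (2 * d + 1)) := by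
      nlinarith
    exact le_of_mul_le_mul_right h4 h3
  have hη1 : η ≤ 3 / 64 := by nlinarith
  have hd2 : ((d + 2 : ℕ) : ℝ) = d + 2 := by push_cast; ring
  have e1 : ((d + 2 : ℝ) / (d + 1)) ^ (d + 2) ≤ exp (4 / 3) := by
    have h2 : (d + 2 : ℝ) / (d + 1) ≤ exp (1 / (d + 1)) := by
      refine le_trans (le_of_eq ?_) (add_one_le_exp (1 / ((d : ℝ) + 1)))
      field_simp; ring
    calc _ ≤ exp (1 / (d + 1)) ^ (d + 2) := by gcongr
      _ = exp ((d + 2) * (1 / (d + 1))) := by rw [← exp_nat_mul, hd2]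
      _ ≤ _ := by
        refine exp_le_exp.2 ?_
        rw [mul_one_div, div_le_div_iff₀ (by positivity) (by norm_num)]
        linarith
  have e2 : ((1 + η) / (1 - η)) ^ (d + 2) ≤ exp (24 / 61) := by
    have h2 : (1 + η) / (1 - η) ≤ exp (128 / 61 * η) := by
      refine le_trans ?_ (add_one_le_exp (128 / 61 * η))
      rw [div_le_iff₀ (by linarith)]
      nlinarith
    calc _ ≤ exp (128 / 61 * η) ^ (d + 2) := by
          have : 0 ≤ (1 + η) / (1 - η) := div_nonneg (by linarith) (by linarith)
          gcongr
      _ = exp ((d + 2) * (128 / 61 * η)) := by rw [← exp_nat_mul, hd2]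
      _ ≤ _ := exp_le_exp.2 (by linarith)
  have e3 : ((d + 1 : ℝ) / d) ^ (d + 2) ≤ exp 2 := by
    have h2 : (d + 1 : ℝ) / d ≤ exp (1 / d) := by
      refine le_trans (le_of_eq ?_) (add_one_le_exp (1 / (d : ℝ)))
      field_simp; ring
    calc _ ≤ exp (1 / d) ^ (d + 2) := by gcongr
      _ = exp ((d + 2) * (1 / d)) := by rw [← exp_nat_mul, hd2]
      _ ≤ _ := by
        refine exp_le_exp.2 ?_
        rw [mul_one_div, div_le_iff₀ (by positivity)]
        linarith
  have hexp : exp (11 / 2) ≤ 288 := by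
    have h2 : exp (11 / 2) ^ 2 ≤ 288 ^ 2 := by
      have h3 : exp (11 / 2) ^ 2 = exp 1 ^ 11 := by
        rw [← exp_nat_mul, ← exp_nat_mul]; norm_num
      rw [h3]
      calc exp 1 ^ 11 ≤ 2.7182818286 ^ 11 := by gcongr; exact exp_one_lt_d9.le
        _ ≤ _ := by norm_num
    exact le_of_sq_le_sq h2 (by norm_num)
  have hprod : (exp (4 / 3) * exp (24 / 61)) ^ 2 * exp 2 ≤ 288 := by
    refine le_trans ?_ hexp
    rw [← exp_add, ← exp_nat_mul, ← exp_add]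
    exact exp_le_exp.2 (by norm_num)
  have hpow := sq_sub_one_sq_mul_le hd
  set u := ((d + 2 : ℝ) / (d + 1)) ^ (d + 2) * ((1 + η) / (1 - η)) ^ (d + 2) with hu
  have hfrac : 0 ≤ ((1 + η) / (1 - η)) ^ (d + 2) :=
    pow_nonneg (div_nonneg (by linarith) (by linarith)) _
  have hu0 : 0 ≤ u := by positivity
  have huE : u ≤ exp (4 / 3) * exp (24 / 61) := by rw [hu]; gcongr
  set v := ((d + 1 : ℝ) / d) ^ (d + 2) with hv
  have hv0 : 0 < v := by positivity
  have huv : u ^ 2 * v ≤ 288 := le_trans (by gcongr) hprod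
  have hrw : (6 * (d : ℝ) / (d + 1)) ^ (d + 2) = 6 ^ (d + 2) / v := by
    rw [hv, ← div_pow]; congr 1; field_simp
  rw [mul_pow _ ((1 + η) / (1 - η)), hrw, ← hu, mul_pow, ← mul_div_assoc, le_div_iff₀ hv0]
  calc ((d : ℝ) ^ 2 - 1) ^ 2 * u ^ 2 * v = ((d : ℝ) ^ 2 - 1) ^ 2 * (u ^ 2 * v) := by ring
    _ ≤ ((d : ℝ) ^ 2 - 1) ^ 2 * 288 := by gcongr
    _ ≤ _ := hpow

end Constants

section Stability

lemma zero_mem_of_smul_subset_smul {E : Type*} [NormedAddCommGroup E] [NormedSpace ℝ E] {K : Set E}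
    (hK : IsClosed K) (hne : K.Nonempty) {a b : ℝ} (ha : 0 ≤ a) (hab : a < b)
    (h : a • K ⊆ b • K) : (0 : E) ∈ K := by
  obtain ⟨x, hx⟩ := hne
  have hb : 0 < b := ha.trans_lt hab
  have hmem : ∀ n : ℕ, (a / b) ^ n • x ∈ K := fun n => by
    induction n with
    | zero => simpa using hx
    | succ n ih =>
      obtain ⟨z, hz, hzx⟩ := h (Set.smul_mem_smul_set ih)
      have : (a / b) ^ (n + 1) • x = z := by
        rw [pow_succ', mul_smul, div_eq_inv_mul, mul_smul, ← div_eq_inv_mul, ← hzx]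
        exact inv_smul_smul₀ hb.ne' z
      rwa [this]
  have hlim := (tendsto_pow_atTop_nhds_zero_of_lt_one (div_nonneg ha hb.le)
    ((div_lt_one hb).2 hab)).smul_const x
  rw [zero_smul] at hlim
  exact hK.mem_of_tendsto hlim (Filter.Eventually.of_forall hmem)

variable {d : ℕ}

/-- The width of a body in any direction is at least `|K| / D ^ (d - 1)`. -/
lemma vol_mul_norm_le {K : Set (EuclideanSpace ℝ (Fin d))} (hK : IsCompact K)
    {s : EuclideanSpace ℝ (Fin d)} (hs : s ∈ interior K) {D : ℝ}
    (hD : ∀ y ∈ K, ∀ y' ∈ K, ‖y - y'‖ ≤ D) (x : EuclideanSpace ℝ (Fin d)) :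
    vol K * ‖x‖ ≤ (supportFun K x + supportFun K (-x)) * D ^ (d - 1) := by
  have hp := isGauge_supportFun_sub_of_mem_interior hK hs
  have hne : K.Nonempty := ⟨s, interior_subset hs⟩
  rcases eq_or_ne x 0 with rfl | hx
  · have h0 := hp.map_smul 0 le_rfl 0
    simp only [zero_smul, inner_zero_right, sub_zero, zero_mul] at h0
    simp [h0]
  have hx0 : 0 < ‖x‖ := norm_pos_iff.2 hx
  have h1 := volume_le_width_mul_pow hK hne hD (u := ‖x‖⁻¹ • x)
    (by rw [norm_smul, norm_inv, norm_norm, inv_mul_cancel₀ hx0.ne'])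
  have h2 := hp.map_smul ‖x‖⁻¹ (by positivity) x
  have h3 := hp.map_smul ‖x‖⁻¹ (by positivity) (-x)
  simp only [real_inner_smul_right, inner_neg_right, smul_neg] at h2 h3
  have h4 : supportFun K (‖x‖⁻¹ • x) + supportFun K (-(‖x‖⁻¹ • x)) =
      ‖x‖⁻¹ * (supportFun K x + supportFun K (-x)) := by linear_combination h2 + h3
  rw [h4, finrank_euclideanSpace_fin] at h1
  calc vol K * ‖x‖ ≤ ‖x‖⁻¹ * (supportFun K x + supportFun K (-x)) * D ^ (d - 1) * ‖x‖ := by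
        gcongr; exact h1
    _ = _ := by field_simp

lemma vol_le_unitBallVol_mul_pow {K : Set (EuclideanSpace ℝ (Fin d))} {D : ℝ} (hD : 0 ≤ D)
    (hK : ∀ y ∈ K, ‖y‖ ≤ D) : vol K ≤ unitBallVol d * D ^ d := by
  have h1 : volume K ≤ volume (Metric.closedBall (0 : EuclideanSpace ℝ (Fin d)) D) :=
    measure_mono fun y hy => mem_closedBall_zero_iff.2 (hK y hy)
  rw [Measure.addHaar_closedBall _ _ hD, finrank_euclideanSpace_fin] at h1
  have h2 := ENNReal.toReal_mono (ENNReal.mul_ne_top ENNReal.ofReal_ne_top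
    measure_ball_lt_top.ne) h1
  rw [ENNReal.toReal_mul, ENNReal.toReal_ofReal (by positivity)] at h2
  rw [vol, unitBallVol, mul_comm]
  exact h2

/-- Comparison of support functions under `(1 - ε) K₀ ⊆ K ⊆ (1 + ε) K₀`. -/
lemma abs_supportFun_sub_le {E : Type*} [NormedAddCommGroup E] [InnerProductSpace ℝ E]
    {K0 K : Set E} (hK0 : IsCompact K0) (hK : IsCompact K) (hne0 : K0.Nonempty)
    (hne : K.Nonempty) {ε : ℝ} (hε0 : 0 < ε) (hε1 : ε < 1)
    (hsub1 : (1 - ε) • K0 ⊆ K) (hsub2 : K ⊆ (1 + ε) • K0) (x : E) :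
    |supportFun K x - supportFun K0 x| ≤ ε * supportFun K0 x := by
  have h1 : supportFun K x ≤ (1 + ε) * supportFun K0 x := supportFun_le hne fun y hy => by
    obtain ⟨z, hz, rfl⟩ := hsub2 hy
    simp only [real_inner_smul_left]
    exact mul_le_mul_of_nonneg_left (inner_le_supportFun hK0 hz x) (by linarith)
  have h2 : supportFun K0 x ≤ supportFun K x / (1 - ε) := supportFun_le hne0 fun y hy => by
    have := inner_le_supportFun hK (hsub1 (Set.smul_mem_smul_set hy)) x
    rw [real_inner_smul_left] at this
    rw [le_div_iff₀ (by linarith)]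
    linarith
  rw [le_div_iff₀ (by linarith)] at h2
  rw [abs_le]
  constructor <;> linarith

/-- Combines the estimate for the squared distance with the numerical inequalities. -/
lemma le_of_sq_le_stability_bound {D V X lam G ε w : ℝ} (hD : 0 < D)
    (hd : 2 ≤ d) (hX : X = D ^ d / V) (hX1 : 1 ≤ X) (hlam : 0 ≤ lam) (hε : 0 ≤ ε)
    (hG : G ^ 2 ≤ d * (6 * d / (d + 1)) ^ (d + 2))
    (hlam2 : 6 * (d : ℝ) ^ 2 / (d + 1) ≤ lam ^ 2)
    (hw : w ^ 2 ≤ d * (d * X) ^ (d + 2) * (ε * D * G) ^ 2) :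
    w ≤ D ^ ((d + 1) ^ 2) / V ^ (d + 2) * d * lam ^ (d + 2) * ε := by
  have hpow : D ^ ((d + 1) ^ 2) / V ^ (d + 2) = D * X ^ (d + 2) := by
    rw [hX, div_pow, ← pow_mul, ← mul_div_assoc, ← pow_succ']
    congr 2
    ring
  have hX0 : 0 < X := by linarith
  rw [hpow]
  refine le_of_sq_le_sq (hw.trans ?_) (by positivity)
  have h1 : (d : ℝ) ^ (d + 2) * G ^ 2 ≤ d * (lam ^ 2) ^ (d + 2) :=
    calc (d : ℝ) ^ (d + 2) * G ^ 2 ≤ (d : ℝ) ^ (d + 2) * (d * (6 * d / (d + 1)) ^ (d + 2)) := by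
          gcongr
      _ = d * (6 * (d : ℝ) ^ 2 / (d + 1)) ^ (d + 2) := by
          rw [mul_left_comm, ← mul_pow]; congr 2; ring
      _ ≤ _ := by gcongr
  have h2 : X ^ (d + 2) ≤ (X ^ (d + 2)) ^ 2 :=
    le_self_pow₀ (one_le_pow₀ hX1) two_ne_zero
  calc d * (d * X) ^ (d + 2) * (ε * D * G) ^ 2
      = d * (ε * D) ^ 2 * X ^ (d + 2) * ((d : ℝ) ^ (d + 2) * G ^ 2) := by rw [mul_pow]; ring
    _ ≤ d * (ε * D) ^ 2 * (X ^ (d + 2)) ^ 2 * (d * (lam ^ 2) ^ (d + 2)) := by gcongr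
    _ = _ := by rw [← pow_mul, ← pow_mul]; ring

end Stability

/-- First part of the Santaló-point stability lemma: if
`(1−ε₁)K₀ ⊆ K ⊆ (1+ε₁)K₀` with `ε₁` small enough, then
`‖s(K) − s(K₀)‖ ≤ c₁(K₀)·ε₁`, where
`c₁(K₀) = (diam K₀)^{(d+1)²}·|K₀|^{−d−2}·d·(d·κ_d/κ_{d−1})^{d+2}`. -/
theorem santalo_point_stability (d : ℕ) (hd : 2 ≤ d)
    (K0 K : Set (EuclideanSpace ℝ (Fin d)))
    (hK0 : IsConvexBody K0) (hK : IsConvexBody K)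
    (ε1 : ℝ) (hε1 : 0 < ε1)
    (hε1le : ε1 ≤ min (1 / 2)
      ((1 / 2 ^ (2 * d + 1)) * (unitBallVol (d - 1) / (d * unitBallVol d ^ 2)) *
        (vol K0 / Metric.diam K0 ^ d)))
    (hsub1 : (1 - ε1) • K0 ⊆ K) (hsub2 : K ⊆ (1 + ε1) • K0)
    (sK sK0 : EuclideanSpace ℝ (Fin d))
    (hsK : IsSantaloPoint K sK) (hsK0 : IsSantaloPoint K0 sK0) :
    ‖sK - sK0‖ ≤
      (Metric.diam K0 ^ ((d + 1) ^ 2) / vol K0 ^ (d + 2)) * d *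
        (d * unitBallVol d / unitBallVol (d - 1)) ^ (d + 2) * ε1 := by
  obtain ⟨-, hcK0, -⟩ := hK0
  obtain ⟨-, hcK, -⟩ := hK
  have hne0 : K0.Nonempty := ⟨sK0, interior_subset hsK0.1⟩
  have hne : K.Nonempty := ⟨sK, interior_subset hsK.1⟩
  have : Nontrivial (EuclideanSpace ℝ (Fin d)) := by
    refine Module.nontrivial_of_finrank_pos (R := ℝ) ?_
    rw [finrank_euclideanSpace_fin]; omega
  have hd' : (2 : ℝ) ≤ d := by exact_mod_cast hd
  have hεhalf : ε1 ≤ 1 / 2 := hε1le.trans (min_le_left _ _)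
  replace hε1le := hε1le.trans (min_le_right _ _)
  have hκ0 : 0 < unitBallVol d := unitBallVol_pos (by omega)
  have hκ1 : 0 < unitBallVol (d - 1) := unitBallVol_pos (by omega)
  set D := Metric.diam K0 with hDdef
  have hD : ∀ y ∈ K0, ∀ y' ∈ K0, ‖y - y'‖ ≤ D := fun y hy y' hy' => by
    rw [← dist_eq_norm]; exact Metric.dist_le_diam_of_mem hcK0.isBounded hy hy'
  set V := vol K0 with hVdef
  have hV : 0 < V := ENNReal.toReal_pos
    (Measure.measure_pos_of_nonempty_interior volume ⟨sK0, hsK0.1⟩).ne' hcK0.measure_lt_top.ne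
  have h0mem : (0 : EuclideanSpace ℝ (Fin d)) ∈ K0 :=
    zero_mem_of_smul_subset_smul hcK0.isClosed hne0 (by linarith) (by linarith : 1 - ε1 < 1 + ε1)
      (hsub1.trans hsub2)
  have hDnonneg : 0 ≤ D := Metric.diam_nonneg
  have hVball : V ≤ unitBallVol d * D ^ d :=
    vol_le_unitBallVol_mul_pow hDnonneg fun y hy => by simpa using hD y hy 0 h0mem
  have hDpos : 0 < D := by
    refine hDnonneg.lt_of_ne' fun h => ?_
    rw [h, zero_pow (by omega), mul_zero] at hVball
    linarith
  have hWD := supportFun_add_neg_le hne0 hD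
  have hWV := vol_mul_norm_le hcK0 hsK0.1 hD
  rw [← hVdef] at hWV
  have hDsucc : D ^ d = D * D ^ (d - 1) := by rw [← pow_succ']; congr 1; omega
  have hX1 : 1 ≤ D ^ d / V := by
    obtain ⟨x, hx⟩ := exists_ne (0 : EuclideanSpace ℝ (Fin d))
    have hx0 : 0 < ‖x‖ := norm_pos_iff.2 hx
    rw [one_le_div hV, hDsucc]
    refine le_of_mul_le_mul_right ((hWV x).trans ?_) hx0
    calc _ ≤ D * ‖x‖ * D ^ (d - 1) := by gcongr; exact hWD x
      _ = _ := by ring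
  have hlam2 := two_le_mul_unitBallVol_div hd
  have hη : (d + 1) * ε1 * (2 * 2 ^ (2 * d + 1)) ≤ (d : ℝ) + 1 := by
    have h1 : V / D ^ d ≤ unitBallVol d := (div_le_iff₀ (by positivity)).2 hVball
    have h2 : 2 * (unitBallVol (d - 1) / (d * unitBallVol d ^ 2)) * unitBallVol d ≤ 1 := by
      rw [le_div_iff₀ hκ1] at hlam2
      rw [mul_div_assoc', div_mul_eq_mul_div, div_le_one (by positivity)]
      nlinarith
    have h3 : ε1 * (2 * 2 ^ (2 * d + 1)) ≤ 1 := by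
      calc ε1 * (2 * 2 ^ (2 * d + 1))
          ≤ (1 / 2 ^ (2 * d + 1) * (unitBallVol (d - 1) / (d * unitBallVol d ^ 2)) *
            unitBallVol d) * (2 * 2 ^ (2 * d + 1)) := by
            gcongr; exact hε1le.trans (by gcongr)
        _ = 2 * (unitBallVol (d - 1) / (d * unitBallVol d ^ 2)) * unitBallVol d := by
            field_simp
        _ ≤ 1 := h2
    nlinarith
  have hη0 : 0 ≤ (d + 1) * ε1 := by positivity
  have hη1 : (d + 1) * ε1 < 1 := by
    have h1 := add_one_mul_add_two_le hd
    have h2 : (0 : ℝ) < 2 * 2 ^ (2 * d + 1) := by positivity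
    refine lt_of_mul_lt_mul_right (hη.trans_lt ?_) h2.le
    nlinarith
  have hdiff := abs_supportFun_sub_le hcK0 hcK hne0 hne hε1 (by linarith) hsub1 hsub2
  have hnn : ∀ x, 0 ≤ supportFun K0 x := fun x => by
    simpa using inner_le_supportFun hcK0 h0mem x
  have ha := isGauge_supportFun_sub_of_mem_interior hcK0 hsK0.1
  have hc := isGauge_supportFun_sub_of_mem_interior hcK hsK.1
  have hasym0 := hsK0.supportFun_neg_le hcK0
  have hasym := hsK.supportFun_neg_le hcK
  simp only [inner_neg_right] at hasym0 hasym
  have haW : ∀ x, supportFun K0 x + supportFun K0 (-x) ≤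
      (d + 1) * (supportFun K0 x - ⟪sK0, x⟫) := fun x => by linarith [hasym0 x]
  have hWa : ∀ x, (d + 1) * (supportFun K0 x - ⟪sK0, x⟫) ≤
      d * (supportFun K0 x + supportFun K0 (-x)) := fun x => by
    have := hasym0 (-x)
    rw [neg_neg, inner_neg_right] at this
    linarith
  have hcW : ∀ x, (d + 1) * (supportFun K x - ⟪sK, x⟫) ≤
      d * (supportFun K x + supportFun K (-x)) := fun x => by
    have := hasym (-x)
    rw [neg_neg, inner_neg_right] at this
    linarith
  set m := V / ((d + 1) * D ^ (d - 1)) with hmdef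
  have hm : 0 < m := by positivity
  have hma : ∀ x, m * ‖x‖ ≤ supportFun K0 x - ⟪sK0, x⟫ := fun x => by
    rw [hmdef, div_mul_eq_mul_div, div_le_iff₀ (by positivity)]
    calc V * ‖x‖ ≤ (supportFun K0 x + supportFun K0 (-x)) * D ^ (d - 1) := hWV x
      _ ≤ (d + 1) * (supportFun K0 x - ⟪sK0, x⟫) * D ^ (d - 1) := by gcongr; exact haW x
      _ = _ := by ring
  have haM : ∀ x, supportFun K0 x - ⟪sK0, x⟫ ≤ d / (d + 1) * D * ‖x‖ := fun x => by
    rw [mul_assoc, div_mul_eq_mul_div, le_div_iff₀ (by positivity)]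
    nlinarith [hWa x, hWD x]
  have hab : ∀ x, |(supportFun K x - ⟪sK0, x⟫) - (supportFun K0 x - ⟪sK0, x⟫)| ≤
      (d + 1) * ε1 * (supportFun K0 x - ⟪sK0, x⟫) := fun x => by
    rw [sub_sub_sub_cancel_right]
    refine (hdiff x).trans ?_
    nlinarith [haW x, hnn (-x)]
  have hκ : ∀ x, |(supportFun K x - ⟪sK0, x⟫) - (supportFun K0 x - ⟪sK0, x⟫)| ≤
      ε1 * D * ‖x‖ := fun x => by
    rw [sub_sub_sub_cancel_right]
    refine (hdiff x).trans ?_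
    nlinarith [hWD x, hnn (-x)]
  have hb : IsGauge fun x => supportFun K x - ⟪sK0, x⟫ := by
    refine isGauge_supportFun_sub hcK hne (mul_pos (sub_pos.2 hη1) hm) fun x => ?_
    have h1 := (abs_le.1 (hab x)).1
    have h2 := mul_le_mul_of_nonneg_left (hma x) (sub_pos.2 hη1).le
    linarith
  have hca : ∀ x, supportFun K x - ⟪sK, x⟫ ≤
      (1 + (d + 1) * ε1) * (d * (supportFun K0 x - ⟪sK0, x⟫)) := fun x => by
    have h1 := (abs_le.1 (hdiff x)).2
    have h2 := (abs_le.1 (hdiff (-x))).2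
    have ha0 := ha.nonneg x
    have h3 : (d + 1) * (supportFun K x - ⟪sK, x⟫) ≤
        (d + 1) * ((1 + ε1) * (d * (supportFun K0 x - ⟪sK0, x⟫))) :=
      calc _ ≤ d * (supportFun K x + supportFun K (-x)) := hcW x
        _ ≤ d * ((1 + ε1) * (supportFun K0 x + supportFun K0 (-x))) := by gcongr; linarith
        _ ≤ d * ((1 + ε1) * ((d + 1) * (supportFun K0 x - ⟪sK0, x⟫))) := by
            gcongr; exact haW x
        _ = _ := by ring
    refine (le_of_mul_le_mul_left h3 (by positivity)).trans ?_
    gcongr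
    nlinarith
  have hfin : Module.finrank ℝ (EuclideanSpace ℝ (Fin d)) = d := finrank_euclideanSpace_fin
  have hmain := IsGauge.norm_sq_le_of_barycenter ha hb hc (w := sK0 - sK)
    (fun x => by rw [inner_sub_left]; ring) (by rw [hfin]; exact hd) hη1 hab hη0 hκ
    (by rw [hfin]; exact hca) hm (by positivity) hma haM
    (hsK0.integral_inner_eq_zero hcK0 _) (hsK.integral_inner_eq_zero hcK _)
  have hratio : d / (d + 1) * D / m = d * (D ^ d / V) := by
    rw [hmdef, hDsucc]; field_simp
  rw [hfin, hratio, norm_sub_rev] at hmain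
  exact le_of_sq_le_stability_bound hDpos hd rfl hX1 (by linarith) hε1.le
    (stability_constant_le hd hη0 hη) (sq_mul_unitBallVol_div_ge hd) hmain
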